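/- Let H ≤ S_n be semiregular with orbit transversal R, let x ∈ {1,…,n}, and let g ∈ N_{S_n}(H) ∩ Stab_{S_n}(R). Then the composite map that first applies [∅]_g (applying g to every letter) and then applies A_{h_x} equals the composite map that first applies A_{h_{x·g^{-1}}} and then applies [∅]_g. -/

import Mathlib

open scoped Classical Pointwise

/-- The `n`-ary Cantor space: infinite sequences over an `n`-letter alphabet. -/
abbrev Cantor (n : ℕ) := ℕ → Fin n

/-- Prefix a sequence by a finite word. -/
def appendWord {n : ℕ} (θ : List (Fin n)) (x : Cantor n) : Cantor n :=
  fun i => if h : i < θ.length then θ.get ⟨i, h⟩ else x (i - θ.length)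

/-- `x` lies in the cone `[θ]`, i.e. has `θ` as a prefix. -/
def inCone {n : ℕ} (θ : List (Fin n)) (x : Cantor n) : Prop :=
  ∀ i, (h : i < θ.length) → x i = θ.get ⟨i, h⟩

/-- A permutation group is semiregular if no nontrivial element has a fixed point. -/
def Semiregular {n : ℕ} (G : Subgroup (Equiv.Perm (Fin n))) : Prop :=
  ∀ g ∈ G, (∃ x, g x = x) → g = 1

/-- `R` is an orbit transversal for the natural action of `H ≤ S_n` on the `n`
points: it contains exactly one point of each `H`-orbit. -/
def IsTransversal {n : ℕ} (H : Subgroup (Equiv.Perm (Fin n))) (R : Set (Fin n)) : Prop :=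
  ∀ x : Fin n, ∃! r, r ∈ R ∧ ∃ h ∈ H, h x = r

/-- `hmap` assigns to each letter `i` the (unique) element `h_i` of `H` with
`i ⬝ h_i ∈ R`. -/
def IsHmap {n : ℕ} (H : Subgroup (Equiv.Perm (Fin n))) (R : Set (Fin n))
    (hmap : Fin n → Equiv.Perm (Fin n)) : Prop :=
  ∀ i : Fin n, hmap i ∈ H ∧ hmap i i ∈ R

/-- The transducer map `A_h` on the Cantor space: the first letter is moved by
`h`, and each subsequent letter `x_{k+1}` is moved by `h_{x_k}` (here `hmap i`
plays the role of `h_i`). -/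
def AFun {n : ℕ} (h : Equiv.Perm (Fin n)) (hmap : Fin n → Equiv.Perm (Fin n))
    (x : Cantor n) : Cantor n
  | 0 => h (x 0)
  | k + 1 => hmap (x k) (x (k + 1))

/-- The iterated permutation `[α]_g` (as a function): identity outside the cone
`[α]`, and applying `g` to every letter after the prefix `α` inside it.
With `α = []` this is `[∅]_g`, applying `g` to every letter. -/
noncomputable def iterPermFun {n : ℕ} (α : List (Fin n)) (g : Equiv.Perm (Fin n))
    (x : Cantor n) : Cantor n :=
  if inCone α x then fun i => if i < α.length then x i else g (x i) else x

theorem hmap_conj_aux {n : ℕ}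
    (H : Subgroup (Equiv.Perm (Fin n))) (hH : Semiregular H)
    (R : Set (Fin n)) (hR : IsTransversal H R)
    (hmap : Fin n → Equiv.Perm (Fin n)) (hhmap : IsHmap H R hmap)
    (g : Equiv.Perm (Fin n))
    (hg : g ∈ Subgroup.normalizer (H : Set (Equiv.Perm (Fin n))) ⊓ MulAction.stabilizer (Equiv.Perm (Fin n)) R)
    (i : Fin n) : hmap (g i) = g * hmap i * g⁻¹ := by
  obtain ⟨h1, h2⟩ := hg
  have ha : g * hmap i * g⁻¹ ∈ H := (Subgroup.mem_normalizer_iff.mp h1 _).mp (hhmap i).1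
  have hr : g (hmap i i) ∈ R := by
    have h3 : g • R = R := h2
    rw [← h3]
    exact Set.smul_mem_smul_set (hhmap i).2
  have he : hmap (g i) (g i) = g (hmap i i) :=
    (hR (g i)).unique ⟨(hhmap (g i)).2, _, (hhmap (g i)).1, rfl⟩
      ⟨hr, _, ha, by simp⟩
  have h4 := hH ((g * hmap i * g⁻¹)⁻¹ * hmap (g i))
    (H.mul_mem (H.inv_mem ha) (hhmap (g i)).1) ⟨g i, by simp [he]⟩
  exact (inv_mul_eq_one.mp h4).symm

/-- Let `H ≤ S_n` be semiregular with orbit transversal `R`,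
`x` a point, and `g ∈ N_{S_n}(H) ⊓ Stab_{S_n}(R)`.  Then `[∅]_g` followed by
`A_{h_x}` equals `A_{h_{x⬝g⁻¹}}` followed by `[∅]_g`, where `x ⬝ g⁻¹ = g⁻¹ x`
and `[∅]_s = iterPermFun [] s` applies `s` to every letter. -/
theorem transducer_commute_normalizer (n : ℕ)
    (H : Subgroup (Equiv.Perm (Fin n))) (hH : Semiregular H)
    (R : Set (Fin n)) (hR : IsTransversal H R)
    (hmap : Fin n → Equiv.Perm (Fin n)) (hhmap : IsHmap H R hmap)
    (x : Fin n) (g : Equiv.Perm (Fin n))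
    (hg : g ∈ Subgroup.normalizer (H : Set (Equiv.Perm (Fin n))) ⊓ MulAction.stabilizer (Equiv.Perm (Fin n)) R) :
    ∀ χ : Cantor n,
      AFun (hmap x) hmap (iterPermFun [] g χ)
        = iterPermFun [] g (AFun (hmap (g⁻¹ x)) hmap χ) := by
  intro χ
  have key := hmap_conj_aux H hH R hR hmap hhmap g hg
  have hit : ∀ y : Cantor n, iterPermFun [] g y = fun i => g (y i) := by
    intro y
    simp [iterPermFun, inCone]
  rw [hit, hit]
  funext k
  cases k with
  | zero =>
    have h := key (g⁻¹ x)
    rw [show g (g⁻¹ x) = x by simp] at h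
    simp [AFun, h]
  | succ k => simp [AFun, key]
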